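/- arXiv:2601.22176 — 2 statements merged into one kernel-verified Lean document; each statement's English description precedes it below -/
import Mathlib

section
/- Let n be an odd natural number with n ≥ 3 and t : ZMod n with Nat.gcd n t.val = 1. Let μ be a multiset of positive natural numbers with μ.sum = n satisfying (i) the cardinality of μ is at most n/2 + 1 (natural-number division) and (ii) the number of even elements of μ is even if n % 4 = 1 and odd if n % 4 = 3. Then for every c ∈ μ with c ≥ 2, there exists a series s : Fin n ≃ ZMod n with s 0 = 0 such that the full cycle type of the proliferating permutation σ of s under retrogradation with transposition t equals μ and the σ-orbit of the central note s ((n−1)/2) has size c. That is, any prescribed cycle of length at least 2 can be made the central cycle. -/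
/-- The full cycle type of a permutation: the multiset of the sizes of all its orbits,
with fixed points counted as orbits of size 1. -/
def fullCycleType {α : Type*} [Fintype α] [DecidableEq α] (σ : Equiv.Perm α) : Multiset ℕ :=
  σ.cycleType + Multiset.replicate (Finset.univ.filter fun x => σ x = x).card 1

/-- The proliferating permutation of a series `s` under retrogradation with transposition
`t`: `x ↦ s (rev (s.symm x)) + t`. -/
def ppR {n : ℕ} [NeZero n] (t : ZMod n) (s : Fin n ≃ ZMod n) : Equiv.Perm (ZMod n) :=
  (s.symm.trans (Fin.revPerm.trans s)).trans (Equiv.addRight t)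

namespace Equiv.Perm

section Cycles

variable {α β : Type*} [Fintype α] [DecidableEq α] [Fintype β] [DecidableEq β]

/-- The cycle of `f` through `x`, as a finset (a singleton if `x` is fixed). -/
def cycleFinset (f : Perm α) (x : α) : Finset α :=
  Finset.univ.filter fun y => f.SameCycle x y

/-- The set of all cycles of `f`, fixed points included. -/
def cycleFinsets (f : Perm α) : Finset (Finset α) :=
  Finset.univ.image f.cycleFinset

@[simp]
lemma mem_cycleFinset {f : Perm α} {x y : α} : y ∈ f.cycleFinset x ↔ f.SameCycle x y := by
  simp [cycleFinset]

lemma self_mem_cycleFinset (f : Perm α) (x : α) : x ∈ f.cycleFinset x :=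
  mem_cycleFinset.2 (SameCycle.refl f x)

lemma cycleFinset_mem_cycleFinsets (f : Perm α) (x : α) : f.cycleFinset x ∈ f.cycleFinsets :=
  Finset.mem_image_of_mem _ (Finset.mem_univ x)

lemma cycleFinset_eq_iff {f : Perm α} {x y : α} :
    f.cycleFinset x = f.cycleFinset y ↔ f.SameCycle x y := by
  constructor
  · intro h
    rw [← mem_cycleFinset, h]
    exact self_mem_cycleFinset f y
  · intro h
    ext z
    simp only [mem_cycleFinset]
    exact ⟨h.symm.trans, h.trans⟩

lemma fullCycleType_eq_map_card (f : Perm α) :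
    fullCycleType f = f.cycleFinsets.val.map Finset.card := by
  have key : f.cycleFinsets = f.cycleFactorsFinset.image support ∪
      (Finset.univ.filter fun x => f x = x).image fun x => {x} := by
    have moved (x : α) (hx : f x ≠ x) : (f.cycleOf x).support = f.cycleFinset x := by
      ext y
      rw [mem_support_cycleOf_iff' hx, mem_cycleFinset]
    have fixed (x : α) (hx : f x = x) : {x} = f.cycleFinset x := by
      ext y
      rw [mem_cycleFinset, Finset.mem_singleton]
      exact ⟨fun h => h ▸ SameCycle.refl f _, fun h => (h.eq_of_left hx).symm⟩
    ext s
    simp only [cycleFinsets, Finset.mem_image, Finset.mem_univ, true_and, Finset.mem_union,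
      Finset.mem_filter]
    constructor
    · rintro ⟨x, rfl⟩
      by_cases hx : f x = x
      · exact Or.inr ⟨x, hx, fixed x hx⟩
      · exact Or.inl ⟨f.cycleOf x, cycleOf_mem_cycleFactorsFinset_iff.2 (mem_support.2 hx),
          moved x hx⟩
    · rintro (⟨c, hc, rfl⟩ | ⟨x, hx, rfl⟩)
      · obtain ⟨x, hx⟩ := (mem_cycleFactorsFinset_iff.1 hc).1.nonempty_support
        have hcx := (cycle_is_cycleOf hx hc)
        have hfx := mem_support.1 (mem_cycleFactorsFinset_support_le hc hx)
        exact ⟨x, by rw [hcx, moved x hfx]⟩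
      · exact ⟨x, (fixed x hx).symm⟩
  have disj : _root_.Disjoint (f.cycleFactorsFinset.image support)
      ((Finset.univ.filter fun x => f x = x).image fun x => ({x} : Finset α)) := by
    simp only [Finset.disjoint_left, Finset.mem_image, not_exists, not_and]
    rintro _ ⟨c, hc, rfl⟩ x - hx
    have := (mem_cycleFactorsFinset_iff.1 hc).1.two_le_card_support
    rw [← hx, Finset.card_singleton] at this
    omega
  have inj : Set.InjOn support (f.cycleFactorsFinset : Set (Perm α)) := by
    intro c hc d hd hcd
    obtain ⟨x, hx⟩ := (mem_cycleFactorsFinset_iff.1 hc).1.nonempty_support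
    rw [cycle_is_cycleOf hx hc, cycle_is_cycleOf (hcd ▸ hx) hd]
  rw [key, ← Finset.disjUnion_eq_union _ _ disj, Finset.disjUnion_val, Multiset.map_add,
    Finset.image_val_of_injOn inj,
    Finset.image_val_of_injOn (Finset.singleton_injective.injOn), Multiset.map_map,
    Multiset.map_map]
  simp only [fullCycleType, cycleType_def, Function.comp_def, Finset.card_singleton,
    Multiset.map_const']
  rfl

end Cycles

section Equiv

variable {α β : Type*} {f : Perm α} {g : Perm β} (e : α ≃ β) (h : ∀ x, e (f x) = g (e x))
include h

lemma sameCycle_equiv_iff {x y : α} : g.SameCycle (e x) (e y) ↔ f.SameCycle x y := by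
  have hg : g = e.permCongr f := by
    ext y
    simp [permCongr_apply, h]
  have hz (k : ℤ) : (e.permCongr f) ^ k = e.permCongr (f ^ k) :=
    (map_zpow e.permCongrHom f k).symm
  subst hg
  simp [SameCycle, hz]

variable [Fintype α] [DecidableEq α] [Fintype β] [DecidableEq β]

lemma cycleFinset_equiv (x : α) :
    g.cycleFinset (e x) = (f.cycleFinset x).map e.toEmbedding := by
  ext y
  obtain ⟨y, rfl⟩ := e.surjective y
  simp [sameCycle_equiv_iff e h]

lemma fullCycleType_equiv : fullCycleType g = fullCycleType f := by
  have : g.cycleFinsets = f.cycleFinsets.map (Finset.mapEmbedding e.toEmbedding).toEmbedding := by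
    ext s
    simp only [cycleFinsets, Finset.mem_image, Finset.mem_univ, true_and, Finset.mem_map,
      exists_exists_eq_and]
    rw [← e.exists_congr_right]
    simp [cycleFinset_equiv e h]
  rw [fullCycleType_eq_map_card, fullCycleType_eq_map_card, this, Finset.map_val, Multiset.map_map]
  exact Multiset.map_congr rfl fun s _ => by simp

end Equiv

section Merge

variable {α : Type*}

lemma SameCycle.of_forall_apply [Finite α] {f : Perm α} {P : α → Prop} (hP : ∀ x, P x → P (f x))
    {x y : α} (h : f.SameCycle x y) (hx : P x) : P y := by
  obtain ⟨i, rfl⟩ := h.exists_nat_pow_eq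
  clear h
  induction i with
  | zero => exact hx
  | succ i ih => rw [pow_succ', mul_apply]; exact hP _ ih

variable [Finite α] [DecidableEq α] {f : Perm α} {x y z w : α}

lemma SameCycle.swap_mul_right (hxy : ¬f.SameCycle x y) (hz : f.SameCycle x z) :
    (swap x y * f).SameCycle y z := by
  have start : (swap x y * f).SameCycle y (f⁻¹ x) := by
    rw [← sameCycle_apply_right]
    simp [SameCycle.refl]
  have h : f⁻¹.SameCycle (f⁻¹ x) z := by
    rwa [sameCycle_apply_left, sameCycle_inv]
  refine (h.of_forall_apply (P := fun w => f.SameCycle x w ∧ (swap x y * f).SameCycle y w) ?_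
    ⟨?_, start⟩).2
  · rintro w ⟨hxw, hyw⟩
    have hw : f.SameCycle x (f⁻¹ w) :=
      sameCycle_inv.1 (sameCycle_apply_right.2 (sameCycle_inv.2 hxw))
    refine ⟨hw, ?_⟩
    by_cases hx : w = x
    · exact hx ▸ start
    · have hy : w ≠ y := fun h => hxy (h ▸ hxw)
      rw [← sameCycle_apply_right]
      simpa [swap_apply_of_ne_of_ne hx hy] using hyw
  · exact sameCycle_inv.1 (sameCycle_apply_right.2 (SameCycle.refl _ _))

lemma SameCycle.swap_mul_left (hxy : ¬f.SameCycle x y) (hz : f.SameCycle y z) :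
    (swap x y * f).SameCycle x z := by
  rw [swap_comm]
  exact SameCycle.swap_mul_right (fun h => hxy h.symm) hz

lemma sameCycle_swap_mul_iff_of_not (hx : ¬f.SameCycle z x) (hy : ¬f.SameCycle z y) :
    (swap x y * f).SameCycle z w ↔ f.SameCycle z w := by
  have step (w : α) (hw : f.SameCycle z w) : (swap x y * f) w = f w := by
    have hw' : f.SameCycle z (f w) := sameCycle_apply_right.2 hw
    exact swap_apply_of_ne_of_ne (fun h => hx (h ▸ hw')) (fun h => hy (h ▸ hw'))
  constructor
  · intro h
    refine h.of_forall_apply (P := fun w => f.SameCycle z w) (fun w hw => ?_) (SameCycle.refl _ _)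
    rw [step w hw]
    exact sameCycle_apply_right.2 hw
  · intro h
    refine (h.of_forall_apply
      (P := fun w => f.SameCycle z w ∧ (swap x y * f).SameCycle z w) ?_
      ⟨SameCycle.refl _ _, SameCycle.refl _ _⟩).2
    rintro w ⟨hw, hw'⟩
    refine ⟨sameCycle_apply_right.2 hw, ?_⟩
    rw [← step w hw]
    exact sameCycle_apply_right.2 hw'

lemma sameCycle_swap_mul_iff (hxy : ¬f.SameCycle x y) :
    (swap x y * f).SameCycle x z ↔ f.SameCycle x z ∨ f.SameCycle y z := by
  have hxy' : (swap x y * f).SameCycle x y := .swap_mul_left hxy (SameCycle.refl _ _)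
  refine ⟨fun h => ?_, ?_⟩
  · by_contra! hz
    exact hz.1 ((sameCycle_swap_mul_iff_of_not (fun h => hz.1 h.symm)
      (fun h => hz.2 h.symm)).1 h.symm).symm
  · rintro (h | h)
    · exact hxy'.trans (.swap_mul_right hxy h)
    · exact .swap_mul_left hxy h

/-- Multiplying a permutation by the transposition of two points that together meet all of its
cycles gives a full cycle. -/
lemma sameCycle_swap_mul_of_cover (hxy : ¬f.SameCycle x y)
    (h : ∀ z, f.SameCycle x z ∨ f.SameCycle y z) (z w : α) : (swap x y * f).SameCycle z w :=
  ((sameCycle_swap_mul_iff hxy).2 (h z)).symm.trans ((sameCycle_swap_mul_iff hxy).2 (h w))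

lemma sameCycle_swap_mul_cover (h : ∀ z w, f.SameCycle z w) (z : α) :
    (swap x y * f).SameCycle x z ∨ (swap x y * f).SameCycle y z := by
  refine (h x z).of_forall_apply
    (P := fun z => (swap x y * f).SameCycle x z ∨ (swap x y * f).SameCycle y z) (fun z hz => ?_)
    (Or.inl (SameCycle.refl _ _))
  by_cases hx : f z = x
  · exact Or.inl (hx ▸ SameCycle.refl _ _)
  by_cases hy : f z = y
  · exact Or.inr (hy ▸ SameCycle.refl _ _)
  have : f z = (swap x y * f) z := (swap_apply_of_ne_of_ne hx hy).symm
  rwa [this, sameCycle_apply_right, sameCycle_apply_right]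

end Merge

section MergeType

variable {α : Type*} [Fintype α] [DecidableEq α] {f : Perm α} {x y z : α}

lemma cycleFinset_swap_mul (hxy : ¬f.SameCycle x y) :
    (swap x y * f).cycleFinset x = f.cycleFinset x ∪ f.cycleFinset y := by
  ext z
  simp [sameCycle_swap_mul_iff hxy]

lemma disjoint_cycleFinset (hxy : ¬f.SameCycle x y) :
    _root_.Disjoint (f.cycleFinset x) (f.cycleFinset y) := by
  rw [Finset.disjoint_left]
  intro z hx hy
  rw [mem_cycleFinset] at hx hy
  exact hxy (hx.trans hy.symm)

lemma card_cycleFinset_swap_mul (hxy : ¬f.SameCycle x y) :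
    ((swap x y * f).cycleFinset x).card = (f.cycleFinset x).card + (f.cycleFinset y).card := by
  rw [cycleFinset_swap_mul hxy, Finset.card_union_of_disjoint (disjoint_cycleFinset hxy)]

lemma cycleFinset_swap_mul_of_not (hx : ¬f.SameCycle z x) (hy : ¬f.SameCycle z y) :
    (swap x y * f).cycleFinset z = f.cycleFinset z := by
  ext w
  simp [sameCycle_swap_mul_iff_of_not hx hy]

lemma fullCycleType_swap_mul (hxy : ¬f.SameCycle x y) {ν : Multiset ℕ}
    (hν : fullCycleType f = (f.cycleFinset x).card ::ₘ (f.cycleFinset y).card ::ₘ ν) :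
    fullCycleType (swap x y * f) = ((f.cycleFinset x).card + (f.cycleFinset y).card) ::ₘ ν := by
  set R := (f.cycleFinsets.erase (f.cycleFinset x)).erase (f.cycleFinset y) with hR
  have hne : f.cycleFinset y ≠ f.cycleFinset x := fun h => hxy (cycleFinset_eq_iff.1 h.symm)
  have hf : f.cycleFinsets = insert (f.cycleFinset x) (insert (f.cycleFinset y) R) := by
    rw [hR, Finset.insert_erase (Finset.mem_erase.2 ⟨hne, cycleFinset_mem_cycleFinsets f y⟩),
      Finset.insert_erase (cycleFinset_mem_cycleFinsets f x)]
  have hg : (swap x y * f).cycleFinsets = insert (f.cycleFinset x ∪ f.cycleFinset y) R := by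
    ext s
    simp only [hR, cycleFinsets, Finset.mem_insert, Finset.mem_erase, Finset.mem_image,
      Finset.mem_univ, true_and]
    constructor
    · rintro ⟨z, rfl⟩
      by_cases hz : (swap x y * f).SameCycle x z
      · left
        rw [← cycleFinset_eq_iff.2 hz, cycleFinset_swap_mul hxy]
      · rw [sameCycle_swap_mul_iff hxy, not_or] at hz
        right
        rw [cycleFinset_swap_mul_of_not (fun h => hz.1 h.symm) (fun h => hz.2 h.symm)]
        exact ⟨fun h => hz.2 (cycleFinset_eq_iff.1 h.symm),
          fun h => hz.1 (cycleFinset_eq_iff.1 h.symm), z, rfl⟩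
    · rintro (rfl | ⟨hy, hx, z, rfl⟩)
      · exact ⟨x, cycleFinset_swap_mul hxy⟩
      · exact ⟨z, cycleFinset_swap_mul_of_not (fun h => hx (cycleFinset_eq_iff.2 h))
          (fun h => hy (cycleFinset_eq_iff.2 h))⟩
  have hU : f.cycleFinset x ∪ f.cycleFinset y ∉ R := by
    intro h
    obtain ⟨z, -, hz⟩ := Finset.mem_image.1 (Finset.mem_of_mem_erase (Finset.mem_of_mem_erase h))
    have hzx := mem_cycleFinset.1 (hz ▸ Finset.mem_union_left _ (self_mem_cycleFinset f x))
    have hzy := mem_cycleFinset.1 (hz ▸ Finset.mem_union_right _ (self_mem_cycleFinset f y))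
    exact hxy (hzx.symm.trans hzy)
  have hx : f.cycleFinset x ∉ insert (f.cycleFinset y) R := by
    simp [hR, hne.symm]
  have hy : f.cycleFinset y ∉ R := by simp [hR]
  rw [fullCycleType_eq_map_card, hf, Finset.insert_val_of_notMem hx,
    Finset.insert_val_of_notMem hy, Multiset.map_cons, Multiset.map_cons, Multiset.cons_inj_right,
    Multiset.cons_inj_right] at hν
  rw [fullCycleType_eq_map_card, hg, Finset.insert_val_of_notMem hU, Multiset.map_cons, hν,
    Finset.card_union_of_disjoint (disjoint_cycleFinset hxy)]

end MergeType

section FullCycle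

variable {α : Type*} [Fintype α] [DecidableEq α] {f : Perm α} {x y z : α}

lemma isCycle_of_forall_sameCycle [Nontrivial α] (h : ∀ z w, f.SameCycle z w) :
    f.IsCycle ∧ f.support = Finset.univ := by
  have hf (z : α) : f z ≠ z := by
    intro hz
    obtain ⟨w, hw⟩ := exists_ne z
    exact hw ((h z w).eq_of_left hz).symm
  obtain ⟨x, -⟩ := exists_pair_ne α
  exact ⟨⟨x, hf x, fun y _ => h x y⟩, by ext; simp [hf]⟩

lemma not_sameCycle_swap_mul (h : ∀ z w, f.SameCycle z w) (hxy : x ≠ y) :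
    ¬(swap x y * f).SameCycle x y := by
  intro hg
  have : Nontrivial α := ⟨x, y, hxy⟩
  have hall (z : α) : (swap x y * f).SameCycle x z :=
    (sameCycle_swap_mul_cover h z).elim id hg.trans
  obtain ⟨hf, hfs⟩ := isCycle_of_forall_sameCycle h
  obtain ⟨hg, hgs⟩ := isCycle_of_forall_sameCycle fun z w => (hall z).symm.trans (hall w)
  have hsign := hg.sign
  rw [hgs, ← hfs, ← hf.sign, sign_mul, sign_swap hxy] at hsign
  simp at hsign

lemma exists_three_cycles {a b c : ℕ} {ν : Multiset ℕ}
    (h : fullCycleType f = a ::ₘ b ::ₘ c ::ₘ ν) :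
    ∃ x y z, ¬f.SameCycle x y ∧ ¬f.SameCycle x z ∧ ¬f.SameCycle y z ∧
      (f.cycleFinset x).card = a ∧ (f.cycleFinset y).card = b ∧ (f.cycleFinset z).card = c := by
  rw [fullCycleType_eq_map_card, ← Multiset.map_eq_cons] at h
  obtain ⟨A, hA, rfl, h⟩ := h
  rw [← Multiset.map_eq_cons] at h
  obtain ⟨B, hB, rfl, h⟩ := h
  rw [← Multiset.map_eq_cons] at h
  obtain ⟨C, hC, rfl, h⟩ := h
  rw [← Finset.erase_val, Finset.mem_val] at hB
  rw [← Finset.erase_val, ← Finset.erase_val, Finset.mem_val] at hC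
  simp only [Finset.mem_erase, Finset.mem_val] at hA hB hC
  obtain ⟨x, -, rfl⟩ := Finset.mem_image.1 hA
  obtain ⟨y, -, rfl⟩ := Finset.mem_image.1 hB.2
  obtain ⟨z, -, rfl⟩ := Finset.mem_image.1 hC.2.2
  exact ⟨x, y, z, fun h => hB.1 (cycleFinset_eq_iff.2 h.symm),
    fun h => hC.2.1 (cycleFinset_eq_iff.2 h.symm),
    fun h => hC.1 (cycleFinset_eq_iff.2 h.symm), rfl, rfl, rfl⟩

lemma exists_card_cycleFinset {a : ℕ} (h : a ∈ fullCycleType f) :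
    ∃ x, (f.cycleFinset x).card = a := by
  rw [fullCycleType_eq_map_card, Multiset.mem_map] at h
  obtain ⟨A, hA, rfl⟩ := h
  obtain ⟨x, -, rfl⟩ := Finset.mem_image.1 hA
  exact ⟨x, rfl⟩

end FullCycle

section Sum

variable {α β : Type*} {f : Perm α} {g : Perm β}

lemma sumCongr_zpow (k : ℤ) : sumCongr f g ^ k = sumCongr (f ^ k) (g ^ k) :=
  (map_zpow (sumCongrHom α β) (f, g) k).symm

@[simp]
lemma sameCycle_sumCongr_inl_inl {x y : α} :
    (sumCongr f g).SameCycle (Sum.inl x) (Sum.inl y) ↔ f.SameCycle x y := by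
  simp [SameCycle, sumCongr_zpow]

@[simp]
lemma sameCycle_sumCongr_inr_inr {x y : β} :
    (sumCongr f g).SameCycle (Sum.inr x) (Sum.inr y) ↔ g.SameCycle x y := by
  simp [SameCycle, sumCongr_zpow]

@[simp]
lemma not_sameCycle_sumCongr_inl_inr {x : α} {y : β} :
    ¬(sumCongr f g).SameCycle (Sum.inl x) (Sum.inr y) := by
  simp [SameCycle, sumCongr_zpow]

@[simp]
lemma not_sameCycle_sumCongr_inr_inl {x : α} {y : β} :
    ¬(sumCongr f g).SameCycle (Sum.inr y) (Sum.inl x) := by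
  simp [SameCycle, sumCongr_zpow]

variable [Fintype α] [DecidableEq α] [Fintype β] [DecidableEq β]

@[simp]
lemma cycleFinset_sumCongr_inl (x : α) :
    (sumCongr f g).cycleFinset (Sum.inl x) = (f.cycleFinset x).map .inl := by
  ext (y | y) <;> simp

@[simp]
lemma cycleFinset_sumCongr_inr (x : β) :
    (sumCongr f g).cycleFinset (Sum.inr x) = (g.cycleFinset x).map .inr := by
  ext (y | y) <;> simp

lemma fullCycleType_sumCongr :
    fullCycleType (sumCongr f g) = fullCycleType f + fullCycleType g := by
  have key : (sumCongr f g).cycleFinsets =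
      f.cycleFinsets.map (Finset.mapEmbedding .inl).toEmbedding ∪
        g.cycleFinsets.map (Finset.mapEmbedding .inr).toEmbedding := by
    ext s
    simp [cycleFinsets]
  have disj : _root_.Disjoint (f.cycleFinsets.map (Finset.mapEmbedding .inl).toEmbedding)
      (g.cycleFinsets.map (Finset.mapEmbedding (.inr : β ↪ α ⊕ β)).toEmbedding) := by
    simp only [Finset.disjoint_left, Finset.mem_map, cycleFinsets, Finset.mem_image,
      Finset.mem_univ, true_and, not_exists, not_and]
    rintro _ ⟨_, ⟨x, rfl⟩, rfl⟩ _ ⟨y, rfl⟩ h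
    have hx : Sum.inl x ∈ (f.cycleFinset x).map (.inl : α ↪ α ⊕ β) :=
      Finset.mem_map_of_mem _ (self_mem_cycleFinset f x)
    have h' : (g.cycleFinset y).map (.inr : β ↪ α ⊕ β) = (f.cycleFinset x).map .inl := h
    rw [← h'] at hx
    simp at hx
  simp only [fullCycleType_eq_map_card]
  rw [key, ← Finset.disjUnion_eq_union _ _ disj, Finset.disjUnion_val, Multiset.map_add,
    Finset.map_val, Finset.map_val, Multiset.map_map, Multiset.map_map]
  congr 1 <;> exact Multiset.map_congr rfl fun s _ => by simp

end Sum

/-- A unicellular map, given by its vertex rotation `σ` and its edge involution `ρ`: the face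
permutation `σ * ρ` is a full cycle. Fixed points of `ρ` are dangling half-edges. -/
structure IsUnicellular {α : Type*} (σ ρ : Perm α) : Prop where
  involutive : ∀ x, ρ (ρ x) = x
  sameCycle : ∀ x y, (σ * ρ).SameCycle x y

section Join

variable {α β : Type*} [Fintype α] [DecidableEq α] [Fintype β] [DecidableEq β]
  {σ ρ : Perm α} {τ π : Perm β}

/-- Identifying a vertex of one unicellular map with a vertex of another. -/
lemma IsUnicellular.join (h : IsUnicellular σ ρ) (h' : IsUnicellular τ π) (x : α) (y : β) :
    IsUnicellular (swap (Sum.inl x) (Sum.inr y) * sumCongr σ τ) (sumCongr ρ π) where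
  involutive := by rintro (z | z) <;> simp [h.involutive, h'.involutive]
  sameCycle := by
    rw [mul_assoc, sumCongr_mul]
    refine sameCycle_swap_mul_of_cover not_sameCycle_sumCongr_inl_inr ?_
    rintro (z | z) <;> simp [h.sameCycle, h'.sameCycle]

lemma fullCycleType_join {x : α} {y : β} {μ ν : Multiset ℕ}
    (hμ : fullCycleType σ = (σ.cycleFinset x).card ::ₘ μ)
    (hν : fullCycleType τ = (τ.cycleFinset y).card ::ₘ ν) :
    fullCycleType (swap (Sum.inl x) (Sum.inr y) * sumCongr σ τ) =
      ((σ.cycleFinset x).card + (τ.cycleFinset y).card) ::ₘ (μ + ν) := by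
  have := fullCycleType_swap_mul (f := sumCongr σ τ) (x := Sum.inl x) (y := Sum.inr y)
    not_sameCycle_sumCongr_inl_inr (ν := μ + ν)
    (by rw [fullCycleType_sumCongr, hμ, hν]; simp [Multiset.cons_swap])
  simpa using this

end Join

/-- The multiset `μ` is the multiset of vertex degrees of a unicellular map without dangling
half-edges. -/
def IsUnicellularType (μ : Multiset ℕ) : Prop :=
  ∃ (α : Type) (_ : Fintype α) (_ : DecidableEq α) (σ ρ : Perm α),
    IsUnicellular σ ρ ∧ (∀ x, ρ x ≠ x) ∧ fullCycleType σ = μ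

lemma isUnicellular_one_boolNot : IsUnicellular (1 : Perm Bool) boolNot where
  involutive := by simp
  sameCycle := by
    intro x y
    by_cases h : x = y
    · exact h ▸ SameCycle.refl _ _
    · exact ⟨1, by cases x <;> cases y <;> simp_all⟩

lemma fullCycleType_one {α : Type*} [Fintype α] [DecidableEq α] :
    fullCycleType (1 : Perm α) = Multiset.replicate (Fintype.card α) 1 := by
  simp [fullCycleType]

lemma cycleFinset_one {α : Type*} [Fintype α] [DecidableEq α] (x : α) :
    (1 : Perm α).cycleFinset x = {x} := by
  ext
  simp [eq_comm]

lemma isUnicellularType_pair : IsUnicellularType {1, 1} :=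
  ⟨Bool, inferInstance, inferInstance, 1, boolNot, isUnicellular_one_boolNot, by simp,
    by rw [fullCycleType_one]; rfl⟩

/-- Attaching a leaf. -/
lemma IsUnicellularType.leaf {d : ℕ} {ν : Multiset ℕ} (h : IsUnicellularType (d ::ₘ ν)) :
    IsUnicellularType ((d + 1) ::ₘ 1 ::ₘ ν) := by
  obtain ⟨α, _, _, σ, ρ, h, hρ, hσ⟩ := h
  obtain ⟨x, hx⟩ := exists_card_cycleFinset (f := σ) (a := d) (by simp [hσ])
  refine ⟨α ⊕ Bool, inferInstance, inferInstance, _, _, h.join isUnicellular_one_boolNot x true,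
    ?_, ?_⟩
  · rintro (z | z) <;> simp [hρ]
  · rw [fullCycleType_join (hx ▸ hσ) (y := true) (ν := {1})
      (by rw [fullCycleType_one, cycleFinset_one]; rfl), hx, cycleFinset_one,
      Finset.card_singleton, Multiset.add_comm ν, Multiset.singleton_add]

/-- Gluing three vertices into one. -/
lemma IsUnicellularType.glue {a b c : ℕ} {ν : Multiset ℕ}
    (h : IsUnicellularType (a ::ₘ b ::ₘ c ::ₘ ν)) : IsUnicellularType ((a + b + c) ::ₘ ν) := by
  obtain ⟨α, _, _, σ, ρ, h, hρ, hσ⟩ := h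
  obtain ⟨x, y, z, hxy, hxz, hyz, rfl, rfl, rfl⟩ := exists_three_cycles hσ
  have hne : x ≠ y := fun h => hxy (h ▸ SameCycle.refl _ _)
  have hz : ((swap x y * σ).cycleFinset z) = σ.cycleFinset z :=
    cycleFinset_swap_mul_of_not (fun h => hxz h.symm) (fun h => hyz h.symm)
  have hy : (swap x y * σ).cycleFinset x = (swap x y * σ).cycleFinset y :=
    cycleFinset_eq_iff.2 (.swap_mul_left hxy (SameCycle.refl _ _))
  have hxz' : ¬(swap x y * σ).SameCycle x z := by
    simp [sameCycle_swap_mul_iff hxy, hxz, hyz]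
  have hyz' : ¬(swap x y * σ).SameCycle y z := fun h => hxz' ((cycleFinset_eq_iff.1 hy).trans h)
  have hfull : fullCycleType (swap x y * σ) = ((swap x y * σ).cycleFinset x).card ::ₘ
      ((swap x y * σ).cycleFinset z).card ::ₘ ν := by
    rw [fullCycleType_swap_mul hxy hσ, card_cycleFinset_swap_mul hxy, hz]
  have hT := not_sameCycle_swap_mul h.sameCycle hne
  have hcover (w : α) := sameCycle_swap_mul_cover (x := x) (y := y) h.sameCycle w
  rcases hcover z with hxT | hyT
  · refine ⟨α, inferInstance, inferInstance, swap y z * (swap x y * σ), ρ,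
      ⟨h.involutive, ?_⟩, hρ, ?_⟩
    · rw [mul_assoc, mul_assoc]
      exact sameCycle_swap_mul_of_cover (fun h => hT (hxT.trans h.symm))
        fun w => (hcover w).symm.imp_right hxT.symm.trans
    · rw [fullCycleType_swap_mul hyz' (hy ▸ hfull), ← hy, card_cycleFinset_swap_mul hxy, hz]
  · refine ⟨α, inferInstance, inferInstance, swap x z * (swap x y * σ), ρ,
      ⟨h.involutive, ?_⟩, hρ, ?_⟩
    · rw [mul_assoc, mul_assoc]
      exact sameCycle_swap_mul_of_cover (fun h => hT (h.trans hyT.symm))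
        fun w => (hcover w).imp_right hyT.symm.trans
    · rw [fullCycleType_swap_mul hxz' hfull, card_cycleFinset_swap_mul hxy, hz]

lemma isUnicellularType_tree (k : ℕ) (μ : Multiset ℕ) (hpos : ∀ d ∈ μ, 0 < d)
    (hcard : Multiset.card μ = k + 2) (hsum : μ.sum = 2 * k + 2) : IsUnicellularType μ := by
  induction k generalizing μ with
  | zero =>
    obtain ⟨a, b, rfl⟩ := Multiset.card_eq_two.1 hcard
    have ha := hpos a (by simp)
    have hb := hpos b (by simp)
    simp at hsum
    obtain rfl : a = 1 := by omega
    obtain rfl : b = 1 := by omega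
    exact isUnicellularType_pair
  | succ k ih =>
    have h1 : 1 ∈ μ := by
      by_contra h1
      have := Multiset.card_nsmul_le_sum (s := μ) (a := 2) fun d hd => by
        have := hpos d hd
        have : d ≠ 1 := fun h => h1 (h ▸ hd)
        omega
      simp at this
      omega
    obtain ⟨ν, rfl⟩ := Multiset.exists_cons_of_mem h1
    simp only [Multiset.card_cons, Multiset.sum_cons, Multiset.forall_mem_cons] at *
    have h2 : ∃ d ∈ ν, 2 ≤ d := by
      by_contra! h2
      have := Multiset.sum_le_card_nsmul ν 1 fun d hd => by have := h2 d hd; omega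
      simp at this
      omega
    obtain ⟨d, hd, h2⟩ := h2
    obtain ⟨ν, rfl⟩ := Multiset.exists_cons_of_mem hd
    simp only [Multiset.card_cons, Multiset.sum_cons, Multiset.forall_mem_cons] at *
    have := (ih ((d - 1) ::ₘ ν) (by simpa using ⟨by omega, hpos.2.2⟩) (by simp; omega)
      (by simp; omega)).leaf
    rwa [Nat.sub_add_cancel (by omega), Multiset.cons_swap] at this

/-- Every degree sequence allowed by Euler's formula is realized by a unicellular map of
genus `g`. -/
lemma isUnicellularType_of_sum (g : ℕ) (μ : Multiset ℕ) (hμ : μ ≠ 0) (hpos : ∀ d ∈ μ, 0 < d)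
    (hsum : μ.sum + 2 = 2 * Multiset.card μ + 4 * g) : IsUnicellularType μ := by
  induction g generalizing μ with
  | zero =>
    have := Multiset.card_nsmul_le_sum (s := μ) (a := 1) hpos
    simp at this
    have h0 := Multiset.card_pos.2 hμ
    have h1 : Multiset.card μ ≠ 1 := by
      intro h1
      obtain ⟨a, rfl⟩ := Multiset.card_eq_one.1 h1
      have := hpos a (by simp)
      simp at hsum
      omega
    exact isUnicellularType_tree (Multiset.card μ - 2) μ hpos (by omega) (by omega)
  | succ g ih =>
    have h3 : ∃ d ∈ μ, 3 ≤ d := by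
      by_contra! h3
      have := Multiset.sum_le_card_nsmul μ 2 fun d hd => by have := h3 d hd; omega
      simp at this
      omega
    obtain ⟨d, hd, h3⟩ := h3
    obtain ⟨ν, rfl⟩ := Multiset.exists_cons_of_mem hd
    simp only [Multiset.card_cons, Multiset.sum_cons, Multiset.forall_mem_cons] at *
    have := (ih ((d - 2) ::ₘ 1 ::ₘ 1 ::ₘ ν) (by simp) (by simpa using ⟨by omega, hpos.2⟩)
      (by simp; omega)).glue
    rwa [show d - 2 + 1 + 1 = d by omega] at this

/-- Attaching a dangling half-edge to a vertex of degree `d`. -/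
lemma IsUnicellularType.exists_dangling {d : ℕ} {ν : Multiset ℕ}
    (h : IsUnicellularType (d ::ₘ ν)) :
    ∃ (α : Type) (_ : Fintype α) (_ : DecidableEq α) (σ ρ : Perm α) (m : α),
      IsUnicellular σ ρ ∧ (∀ x, ρ x = x ↔ x = m) ∧ fullCycleType σ = (d + 1) ::ₘ ν ∧
        (σ.cycleFinset m).card = d + 1 := by
  obtain ⟨α, _, _, σ, ρ, h, hρ, hσ⟩ := h
  obtain ⟨x, hx⟩ := exists_card_cycleFinset (f := σ) (a := d) (by simp [hσ])
  have h1 : IsUnicellular (1 : Perm Unit) 1 := ⟨by simp, by simp⟩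
  refine ⟨α ⊕ Unit, inferInstance, inferInstance, _, _, Sum.inr (), h.join h1 x (), ?_, ?_, ?_⟩
  · rintro (z | z) <;> simp [hρ]
  · rw [fullCycleType_join (hx ▸ hσ) (y := ()) (ν := 0)
      (by rw [fullCycleType_one, cycleFinset_one]; rfl), hx, cycleFinset_one]
    simp
  · rw [← cycleFinset_eq_iff.2 (SameCycle.swap_mul_left (f := sumCongr σ 1)
      not_sameCycle_sumCongr_inl_inr (SameCycle.refl _ _)),
      card_cycleFinset_swap_mul not_sameCycle_sumCongr_inl_inr]
    simp [hx, cycleFinset_one]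

section Transport

variable {α β : Type*} {f : Perm α} {g : Perm β}

lemma exists_equiv_of_isConj (e : α ≃ β) (h : IsConj (e.permCongr f) g) :
    ∃ e' : α ≃ β, ∀ x, e' (f x) = g (e' x) := by
  obtain ⟨c, hc⟩ := isConj_iff.1 h
  refine ⟨e.trans c, fun x => ?_⟩
  rw [← hc]
  simp

variable [Fintype α] [Fintype β] [DecidableEq β]

lemma sum_fullCycleType [DecidableEq α] (f : Perm α) : (fullCycleType f).sum = Fintype.card α := by
  have h : f.support = Finset.univ.filter fun x => ¬f x = x := by
    ext
    simp
  simp only [fullCycleType, Multiset.sum_add, sum_cycleType, h, Multiset.sum_replicate, smul_eq_mul,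
    mul_one]
  rw [add_comm, Finset.card_filter_add_card_filter_not, Finset.card_univ]

lemma exists_equiv_of_forall_sameCycle [Nontrivial α] (hcard : Fintype.card α = Fintype.card β)
    (hf : ∀ x y, f.SameCycle x y) (hg : ∀ x y, g.SameCycle x y) :
    ∃ e : α ≃ β, ∀ x, e (f x) = g (e x) := by
  let e := Fintype.equivOfCardEq hcard
  have : Nontrivial β := e.symm.nontrivial
  have hef (x y : β) : (e.permCongr f).SameCycle x y := by
    rw [← e.apply_symm_apply x, ← e.apply_symm_apply y, sameCycle_equiv_iff e (f := f) (by simp)]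
    exact hf _ _
  obtain ⟨h1, h2⟩ := isCycle_of_forall_sameCycle hef
  obtain ⟨h3, h4⟩ := isCycle_of_forall_sameCycle hg
  exact exists_equiv_of_isConj e (h1.isConj h3 (by rw [h2, h4]))

lemma cycleType_of_involutive [DecidableEq α] {x : α} (hf : ∀ z, f (f z) = z)
    (hx : ∀ z, f z = z ↔ z = x) :
    f.cycleType = Multiset.replicate ((Fintype.card α - 1) / 2) 2 := by
  have htwo : ∀ d ∈ f.cycleType, d = 2 := by
    intro d hd
    have h1 := (dvd_of_mem_cycleType hd).trans
      (orderOf_dvd_of_pow_eq_one (n := 2) (by ext z; simp [sq, hf]))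
    have h2 := two_le_of_mem_cycleType hd
    have := Nat.le_of_dvd (by norm_num) h1
    omega
  have hsupp : f.support = Finset.univ.erase x := by
    ext
    simp [hx]
  have hsum := f.sum_cycleType
  rw [Multiset.eq_replicate_card.2 htwo, hsupp, Multiset.sum_replicate,
    Finset.card_erase_of_mem (Finset.mem_univ x), Finset.card_univ, smul_eq_mul] at hsum
  rw [Multiset.eq_replicate]
  exact ⟨by omega, htwo⟩

lemma exists_equiv_of_involutive {x : α} {y : β} (hcard : Fintype.card α = Fintype.card β)
    (hf : ∀ z, f (f z) = z) (hg : ∀ z, g (g z) = z) (hx : ∀ z, f z = z ↔ z = x)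
    (hy : ∀ z, g z = z ↔ z = y) : ∃ e : α ≃ β, ∀ z, e (f z) = g (e z) := by
  let e := Fintype.equivOfCardEq hcard
  refine exists_equiv_of_isConj e (isConj_of_cycleType_eq ?_)
  rw [cycleType_of_involutive hg hy, cycleType_of_involutive (x := e x) (by simp [hf])]
  intro z
  rw [permCongr_apply, ← e.eq_symm_apply, hx, e.symm_apply_eq]

end Transport

lemma sameCycle_addRight {n : ℕ} [NeZero n] {t : ZMod n} (ht : Nat.gcd n t.val = 1)
    (x y : ZMod n) : SameCycle (Equiv.addRight t) x y := by
  have hu : IsUnit t := by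
    rw [← ZMod.natCast_zmod_val t, ZMod.isUnit_iff_coprime]
    exact Nat.Coprime.symm ht
  obtain ⟨u, rfl⟩ := hu
  have hpow (k : ℕ) : (Equiv.addRight (u : ZMod n) ^ k) x = x + k * u := by
    induction k with
    | zero => simp
    | succ k ih =>
      rw [pow_succ', mul_apply, ih, Equiv.coe_addRight]
      push_cast
      ring
  obtain ⟨k, hk⟩ := ZMod.natCast_zmod_surjective ((y - x) * ((u⁻¹ : (ZMod n)ˣ) : ZMod n))
  refine ⟨k, ?_⟩
  rw [zpow_natCast, hpow, hk, Units.inv_mul_cancel_right]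
  ring

lemma even_card_filter_even_add (μ : Multiset ℕ) :
    Even (Multiset.card (μ.filter fun c => Even c) + μ.sum + Multiset.card μ) := by
  induction μ using Multiset.induction with
  | empty => simp
  | cons a μ ih =>
    by_cases ha : Even a
    · simp only [Multiset.filter_cons_of_pos _ ha, Multiset.card_cons, Multiset.sum_cons]
      grind
    · simp only [Multiset.filter_cons_of_neg _ ha, Multiset.card_cons, Multiset.sum_cons]
      grind

end Equiv.Perm

open Equiv.Perm

/-- for `n` odd, `n ≥ 3`, `gcd n t.val = 1`, and `μ` an admissible cycle
structure, any prescribed element `c ∈ μ` with `c ≥ 2` can be realized as the length of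
the central cycle: there is a series `s` with `s 0 = 0` whose R proliferating permutation
has full cycle type `μ` and whose orbit of the central note `s ((n-1)/2)` has size `c`. -/
theorem stmt_18 (n : ℕ) [NeZero n] (hn : Odd n) (hn3 : 3 ≤ n)
    (t : ZMod n) (ht : Nat.gcd n t.val = 1)
    (μ : Multiset ℕ) (hμ : ∀ c ∈ μ, 0 < c) (hsum : μ.sum = n)
    (hcard : Multiset.card μ ≤ n / 2 + 1)
    (heven : n % 4 = 1 → Even (Multiset.card (μ.filter fun c => Even c)))
    (hodd : n % 4 = 3 → Odd (Multiset.card (μ.filter fun c => Even c))) :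
    ∀ c ∈ μ, 2 ≤ c →
      ∃ s : Fin n ≃ ZMod n, s 0 = 0 ∧ fullCycleType (ppR t s) = μ ∧
        Set.ncard {y : ZMod n |
          ∃ m : ℤ, ((ppR t s) ^ m) (s ⟨(n - 1) / 2, by omega⟩) = y} = c := by
  intro c hc hc2
  obtain ⟨ν, rfl⟩ := Multiset.exists_cons_of_mem hc
  have hpar := even_card_filter_even_add (c ::ₘ ν)
  have h4 : n + 1 =
      2 * Multiset.card (c ::ₘ ν) + 4 * ((n + 1 - 2 * Multiset.card (c ::ₘ ν)) / 4) := by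
    rw [hsum] at hpar
    generalize Multiset.card (c ::ₘ ν) = k at *
    generalize Multiset.card ((c ::ₘ ν).filter fun c => Even c) = j at *
    simp only [Nat.even_iff, Nat.odd_iff] at hn heven hodd hpar
    omega
  obtain ⟨d, rfl⟩ : ∃ d, c = d + 1 := ⟨c - 1, by omega⟩
  simp only [Multiset.sum_cons, Multiset.forall_mem_cons] at hsum hμ
  have htype : IsUnicellularType (d ::ₘ ν) :=
    isUnicellularType_of_sum ((n + 1 - 2 * Multiset.card ((d + 1) ::ₘ ν)) / 4) _ (by simp)
      (by simpa using ⟨by omega, hμ.2⟩) (by simp at h4 ⊢; omega)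
  obtain ⟨α, _, _, σ, ρ, m, hσρ, hm, hσ, hmc⟩ := htype.exists_dangling
  have hα : Fintype.card α = n := by
    rw [← sum_fullCycleType σ, hσ, Multiset.sum_cons, hsum]
  have : Nontrivial α := Fintype.one_lt_card_iff_nontrivial.1 (by omega)
  obtain ⟨s, hs⟩ := exists_equiv_of_involutive (f := Fin.revPerm (n := n)) (g := ρ)
    (x := ⟨(n - 1) / 2, by omega⟩) (y := m) (by simp [hα]) (by simp) hσρ.involutive
    (fun i => by
      obtain ⟨k, rfl⟩ := hn
      simp only [Fin.revPerm_apply, Fin.ext_iff, Fin.val_rev]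
      omega) hm
  obtain ⟨e, he⟩ := exists_equiv_of_forall_sameCycle (f := σ * ρ) (g := Equiv.addRight t)
    (by simp [hα, ZMod.card]) hσρ.sameCycle (sameCycle_addRight ht)
  have hsm : s ⟨(n - 1) / 2, by omega⟩ = m := by
    rw [← hm, ← hs]
    congr 1
    obtain ⟨k, rfl⟩ := hn
    simp only [Fin.revPerm_apply, Fin.ext_iff, Fin.val_rev]
    omega
  let u : α ≃ ZMod n := e.trans (Equiv.subRight (e (s 0)))
  have hu (x : α) : u (σ x) = ppR t (s.trans u) (u x) := by
    have h1 : u (σ x) = u (ρ x) + t := by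
      have := he (ρ x)
      simp only [mul_apply, hσρ.involutive, Equiv.coe_addRight] at this
      simp only [u, Equiv.trans_apply, Equiv.subRight_apply, this]
      ring
    have h2 : s (Fin.revPerm (s.symm x)) = ρ x := by simpa using hs (s.symm x)
    rw [h1, ← h2]
    simp [ppR]
  refine ⟨s.trans u, by simp [u], (fullCycleType_equiv u hu).trans hσ, ?_⟩
  have hset : {y : ZMod n | ∃ k : ℤ, ((ppR t (s.trans u)) ^ k)
      ((s.trans u) ⟨(n - 1) / 2, by omega⟩) = y} = (ppR t (s.trans u)).cycleFinset (u m) := by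
    ext y
    simp [SameCycle, hsm]
  rw [hset, Set.ncard_coe_finset, cycleFinset_equiv u hu, Finset.card_map, hmc]
end

section
/- Let n be a positive natural number and let t₁, t₂ : ZMod n satisfy Nat.gcd n t₁.val = Nat.gcd n t₂.val. Then for every multiset m of natural numbers, the number of series s : Fin n ≃ ZMod n with s 0 = 0 whose proliferating permutation under retrogradation with transposition t₁ has full cycle type m equals the number of series s : Fin n ≃ ZMod n with s 0 = 0 whose proliferating permutation under retrogradation with transposition t₂ has full cycle type m. In particular, the set of achievable cycle structures under retrogradation depends on t only through gcd(n, t). -/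
/-- The full cycle type is invariant under conjugation. -/
theorem fullCycleType_conj {α : Type*} [Fintype α] [DecidableEq α] (σ τ : Equiv.Perm α) :
    fullCycleType (τ * σ * τ⁻¹) = fullCycleType σ := by
  have hfix : (Finset.univ.filter fun x => (τ * σ * τ⁻¹) x = x).card =
      (Finset.univ.filter fun x => σ x = x).card := by
    refine Finset.card_equiv τ⁻¹ fun x => ?_
    simp [Equiv.Perm.mul_apply, ← Equiv.Perm.eq_inv_iff_eq]
  rw [fullCycleType, fullCycleType, Equiv.Perm.cycleType_conj, hfix]

/-- Elements of `ZMod n` with the same gcd with `n` are associated. -/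
theorem ZMod.exists_unit_mul_eq_of_gcd_val_eq {n : ℕ} [NeZero n] {a b : ZMod n}
    (h : Nat.gcd n a.val = Nat.gcd n b.val) : ∃ u : (ZMod n)ˣ, (u : ZMod n) * a = b := by
  have key (c : ZMod n) : ∃ u : (ZMod n)ˣ, c = u * (Nat.gcd n c.val : ZMod n) := by
    have hg : 0 < Nat.gcd n c.val := Nat.gcd_pos_of_pos_left _ (NeZero.pos n)
    obtain ⟨d, hd⟩ := Nat.gcd_dvd_left n c.val
    have hdn : d ∣ n := ⟨_, by rw [mul_comm]; exact hd⟩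
    have hcop : Nat.Coprime (c.val / Nat.gcd n c.val) d := by
      have := Nat.coprime_div_gcd_div_gcd hg
      rw [Nat.div_eq_of_eq_mul_right hg hd] at this
      exact this.symm
    obtain ⟨u, hu⟩ := ZMod.unitsMap_surjective hdn (ZMod.unitOfCoprime _ hcop)
    refine ⟨u, ?_⟩
    have hu' : ((u : ZMod n).val : ZMod d) = ((c.val / Nat.gcd n c.val : ℕ) : ZMod d) := by
      have := congrArg Units.val hu
      simpa [ZMod.unitsMap_val, ZMod.natCast_val] using this
    rw [ZMod.natCast_eq_natCast_iff] at hu'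
    have := hu'.mul_right' (Nat.gcd n c.val)
    rw [Nat.div_mul_cancel (Nat.gcd_dvd_right n c.val), mul_comm d, ← hd,
      ← ZMod.natCast_eq_natCast_iff] at this
    simpa using this.symm
  obtain ⟨u, hu⟩ := key a
  obtain ⟨v, hv⟩ := key b
  refine ⟨v * u⁻¹, ?_⟩
  rw [hv, ← h]
  nth_rewrite 1 [hu]
  rw [Units.val_mul, mul_assoc, Units.inv_mul_cancel_left]

/-- Multiplying a series and the transposition by a unit conjugates the proliferating
permutation. -/
theorem ppR_mulLeft {n : ℕ} [NeZero n] (u : (ZMod n)ˣ) (t : ZMod n) (s : Fin n ≃ ZMod n) :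
    ppR ((u : ZMod n) * t) (s.trans u.mulLeft) = u.mulLeft * ppR t s * (u.mulLeft)⁻¹ := by
  ext x
  simp [ppR, Equiv.Perm.mul_apply, mul_add, Equiv.Perm.inv_def]

/-- if `gcd n t₁.val = gcd n t₂.val`, then for every multiset `m` the
number of series whose R proliferating permutation with transposition `t₁` has full cycle
type `m` equals the corresponding number for `t₂`. -/
theorem stmt_19 (n : ℕ) [NeZero n] (t₁ t₂ : ZMod n)
    (h : Nat.gcd n t₁.val = Nat.gcd n t₂.val) :
    ∀ m : Multiset ℕ,
      Nat.card {s : Fin n ≃ ZMod n // s 0 = 0 ∧ fullCycleType (ppR t₁ s) = m} =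
        Nat.card {s : Fin n ≃ ZMod n // s 0 = 0 ∧ fullCycleType (ppR t₂ s) = m} := by
  obtain ⟨u, rfl⟩ := ZMod.exists_unit_mul_eq_of_gcd_val_eq h
  intro m
  refine Nat.card_congr (Equiv.subtypeEquiv ((Equiv.refl _).equivCongr u.mulLeft) fun s => ?_)
  change _ ↔ (s.trans u.mulLeft) 0 = 0 ∧ fullCycleType (ppR _ (s.trans u.mulLeft)) = m
  rw [ppR_mulLeft, fullCycleType_conj]
  simp
end
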